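/- arXiv:2302.03407 — 2 statements merged into one kernel-verified Lean document; each statement's English description precedes it below -/
import Mathlib

section
/- Assume ∇_y F and ∇_y f are Lipschitz continuous in (x,y) with the stated constants and that ψ_μ(x,·) is σ_{ψμ}-strongly convex with σ_{ψμ} > 0 for some μ ∈ (0,1]. Then for every D > 0 and every pair (x,y) with ‖x‖ + ‖y‖ ≤ D, one has ‖∇_y F(x, y*_μ(x))‖ ≤ (C_{d1} D + C_{d2}) / σ_{ψμ} and ‖v*_μ(x)‖ ≤ (C_{d1} D + C_{d2}) / σ_{ψμ}², where C_{d1} := L_{Fy2}(L_{fy1} + L_{fy2}) + (σ_{ψμ} + μ L_{Fy2})(L_{Fy1} + L_{Fy2}) and C_{d2} := L_{Fy2} ‖∇_y f(0,0)‖ + (σ_{ψμ} + μ L_{Fy2}) ‖∇_y F(0,0)‖. -/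
open Set Filter Asymptotics
open scoped NNReal

noncomputable section

/-- `ℝⁿ` as a Euclidean space. -/
abbrev Eu (n : ℕ) : Type := EuclideanSpace ℝ (Fin n)

variable {n m : ℕ}

/-- Partial gradient with respect to the first (upper-level) variable. -/
def gradx (F : Eu n → Eu m → ℝ) (x : Eu n) (y : Eu m) : Eu n :=
  gradient (fun x' => F x' y) x

/-- Partial gradient with respect to the second (lower-level) variable. -/
def grady (F : Eu n → Eu m → ℝ) (x : Eu n) (y : Eu m) : Eu m :=
  gradient (fun y' => F x y') y

/-- Second-order partial derivative `∇²_{yy}`. -/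
def hessyy (F : Eu n → Eu m → ℝ) (x : Eu n) (y : Eu m) : Eu m →L[ℝ] Eu m :=
  fderiv ℝ (fun y' => grady F x y') y

/-- Mixed second-order partial derivative `∇²_{xy}`, viewed as the linear map
sending a multiplier `v ∈ ℝᵐ` to an element of `ℝⁿ`. -/
def hessxy (F : Eu n → Eu m → ℝ) (x : Eu n) (y : Eu m) : Eu m →L[ℝ] Eu n :=
  ContinuousLinearMap.adjoint (fderiv ℝ (fun x' => grady F x' y) x)

/-- The aggregation function `ψ_μ = μ F + (1-μ) f`. -/
def aggreg (μ : ℝ) (F f : Eu n → Eu m → ℝ) : Eu n → Eu m → ℝ :=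
  fun x y => μ * F x y + (1 - μ) * f x y

/-- The squared KKT residual of the equality-constrained reformulation
`min F(x,y) s.t. ∇_y f(x,y) = 0`. -/
def KKTres (F f : Eu n → Eu m → ℝ) (x : Eu n) (y v : Eu m) : ℝ :=
  ‖gradx F x y - hessxy f x y v‖ ^ 2 + ‖grady F x y - hessyy f x y v‖ ^ 2 +
    ‖grady f x y‖ ^ 2

/-- First-order characterization of strong convexity at a point of differentiability. -/
theorem StrongConvexOn.add_fderiv_add_le {E : Type*} [NormedAddCommGroup E] [NormedSpace ℝ E]
    {h : E → ℝ} {σ : ℝ} (hc : StrongConvexOn univ σ h) {u : E} {h' : E →L[ℝ] ℝ}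
    (hd : HasFDerivAt h h' u) (w : E) :
    h u + h' (w - u) + σ / 2 * ‖w - u‖ ^ 2 ≤ h w := by
  have hlim := (hd.hasLineDerivAt (w - u)).tendsto_slope_zero_right
  have hlim₂ : Tendsto (fun t : ℝ => h w - h u - (1 - t) * (σ / 2 * ‖w - u‖ ^ 2))
      (nhdsWithin 0 (Ioi 0)) (nhds (h w - h u - (1 - 0) * (σ / 2 * ‖w - u‖ ^ 2))) :=
    (Continuous.tendsto (by fun_prop) 0).mono_left nhdsWithin_le_nhds
  have hle := le_of_tendsto_of_tendsto hlim hlim₂ (by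
    filter_upwards [Ioo_mem_nhdsGT (zero_lt_one' ℝ)] with t ht
    have hconv := hc.2 (mem_univ u) (mem_univ w) (sub_nonneg.2 ht.2.le) ht.1.le (by ring)
    have hpt : (1 - t) • u + t • w = u + t • (w - u) := by module
    rw [hpt, norm_sub_rev u w] at hconv
    simp only [smul_eq_mul] at hconv ⊢
    rw [inv_mul_le_iff₀ ht.1]
    linarith)
  linarith

/-- A strongly convex differentiable function grows its gradient linearly away from a minimizer. -/
theorem StrongConvexOn.mul_norm_sub_le_norm_gradient {E : Type*} [NormedAddCommGroup E]
    [InnerProductSpace ℝ E] [CompleteSpace E] {h : E → ℝ} {σ : ℝ}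
    (hc : StrongConvexOn univ σ h) (hd : Differentiable ℝ h) {z : E} (hz : ∀ w, h z ≤ h w)
    (w : E) : σ * ‖w - z‖ ≤ ‖gradient h w‖ := by
  have hz' : fderiv ℝ h z = 0 := IsLocalMin.fderiv_eq_zero (Eventually.of_forall hz)
  have h₁ := hc.add_fderiv_add_le (hd z).hasFDerivAt w
  have h₂ := hc.add_fderiv_add_le (hd w).hasFDerivAt z
  rw [hz', zero_apply] at h₁
  rw [← inner_gradient_left, norm_sub_rev z w] at h₂
  have h₃ := (abs_le.1 (abs_real_inner_le_norm (gradient h w) (z - w))).1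
  rw [norm_sub_rev z w] at h₃
  rcases (norm_nonneg (w - z)).eq_or_lt with h₀ | h₀
  · simp [← h₀]
  · refine le_of_mul_le_mul_right ?_ h₀
    linarith

theorem ContDiff.gradient_one {E : Type*} [NormedAddCommGroup E]
    [InnerProductSpace ℝ E] [CompleteSpace E] {h : E → ℝ} (hh : ContDiff ℝ 2 h) :
    ContDiff ℝ 1 (gradient h) :=
  (InnerProductSpace.toDual ℝ E).symm.contDiff.comp (hh.fderiv_right (by norm_num))

/-- If `g` vanishes at `z` and grows at least linearly with rate `σ` away from `z`, so does its
derivative at `z`. -/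
theorem HasFDerivAt.mul_norm_le_of_growth {E G : Type*} [NormedAddCommGroup E] [NormedSpace ℝ E]
    [NormedAddCommGroup G] [NormedSpace ℝ G] {g : E → G} {g' : E →L[ℝ] G} {z : E} {σ : ℝ}
    (hg : HasFDerivAt g g' z) (hz : g z = 0) (hgrow : ∀ w, σ * ‖w - z‖ ≤ ‖g w‖) (v : E) :
    σ * ‖v‖ ≤ ‖g' v‖ := by
  refine ge_of_tendsto (hg.lim_real v).norm ?_
  filter_upwards [eventually_gt_atTop (0 : ℝ)] with c hc
  have hv := hgrow (z + c⁻¹ • v)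
  rw [add_sub_cancel_left, norm_smul, norm_inv, Real.norm_of_nonneg hc.le] at hv
  rw [hz, sub_zero, norm_smul, Real.norm_of_nonneg hc.le]
  calc σ * ‖v‖ = c * (σ * (c⁻¹ * ‖v‖)) := by field_simp
    _ ≤ _ := by gcongr

theorem ContinuousLinearMap.mul_norm_inverse_apply_le {E G : Type*} [NormedAddCommGroup E]
    [NormedSpace ℝ E] [NormedAddCommGroup G] [NormedSpace ℝ G] {A : E →L[ℝ] G} {σ : ℝ}
    (hA : ∀ v, σ * ‖v‖ ≤ ‖A v‖) (a : G) : σ * ‖A.inverse a‖ ≤ ‖a‖ := by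
  by_cases h : A.IsInvertible
  · have h₁ := hA (A.inverse a)
    rwa [← (h.inverse_apply_eq).1 rfl] at h₁
  · simp [h]

theorem ContDiff.of_uncurry_right {F : Eu n → Eu m → ℝ} (hF : ContDiff ℝ 2 (Function.uncurry F))
    (x : Eu n) : ContDiff ℝ 2 (F x) :=
  hF.comp (contDiff_const.prodMk contDiff_id)

theorem grady_aggreg {F f : Eu n → Eu m → ℝ} (hF : ContDiff ℝ 2 (Function.uncurry F))
    (hf : ContDiff ℝ 2 (Function.uncurry f)) (μ : ℝ) (x : Eu n) (y : Eu m) :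
    grady (aggreg μ F f) x y = μ • grady F x y + (1 - μ) • grady f x y := by
  have hF' := (hF.of_uncurry_right x).differentiable two_ne_zero y
  have hf' := (hf.of_uncurry_right x).differentiable two_ne_zero y
  have h := ((hF'.hasFDerivAt.const_mul μ).add (hf'.hasFDerivAt.const_mul (1 - μ))).fderiv
  change (InnerProductSpace.toDual ℝ _).symm (fderiv ℝ _ y) = _
  erw [h]
  simp [grady, gradient]

theorem norm_grady_le {F : Eu n → Eu m → ℝ} {L₁ L₂ : ℝ≥0}
    (h₁ : ∀ y, LipschitzWith L₁ fun x => grady F x y)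
    (h₂ : ∀ x, LipschitzWith L₂ fun y => grady F x y) {D : ℝ} {x : Eu n} {y : Eu m}
    (hD : ‖x‖ + ‖y‖ ≤ D) : ‖grady F x y‖ ≤ (L₁ + L₂) * D + ‖grady F 0 0‖ := by
  have hx := (h₁ y).norm_sub_le x 0
  have hy := (h₂ 0).norm_sub_le y 0
  rw [sub_zero] at hx hy
  have hx' := norm_sub_norm_le (grady F x y) (grady F 0 y)
  have hy' := norm_sub_norm_le (grady F 0 y) (grady F 0 0)
  have hxD : L₁ * ‖x‖ ≤ L₁ * D := by gcongr; linarith [norm_nonneg y]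
  have hyD : L₂ * ‖y‖ ≤ L₂ * D := by gcongr; linarith [norm_nonneg x]
  linarith

/-- Lemma A.4: bounds on `‖∇_y F(x, y*_μ(x))‖` and `‖v*_μ(x)‖`
for bounded `(x, y)`. -/
theorem gradF_vstar_bound_of_bounded {n m : ℕ}
    (F f : Eu n → Eu m → ℝ)
    (hF : ContDiff ℝ 2 (Function.uncurry F))
    (hf : ContDiff ℝ 2 (Function.uncurry f))
    (LFy1 LFy2 Lfy1 Lfy2 : ℝ≥0)
    (hLFy1 : ∀ y, LipschitzWith LFy1 fun x => grady F x y)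
    (hLFy2 : ∀ x, LipschitzWith LFy2 fun y => grady F x y)
    (hLfy1 : ∀ y, LipschitzWith Lfy1 fun x => grady f x y)
    (hLfy2 : ∀ x, LipschitzWith Lfy2 fun y => grady f x y)
    (μ : ℝ) (hμ : μ ∈ Ioc (0 : ℝ) 1)
    (σψ : ℝ) (hσψpos : 0 < σψ)
    (hψsc : ∀ x, StrongConvexOn univ σψ (aggreg μ F f x))
    (ystar : Eu n → Eu m)
    (hmin : ∀ x y, aggreg μ F f x (ystar x) ≤ aggreg μ F f x y)
    (vstar : Eu n → Eu m)
    (hvstar : ∀ x, vstar x =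
      (hessyy (aggreg μ F f) x (ystar x)).inverse (grady F x (ystar x)))
    (Cd1 Cd2 : ℝ)
    (hCd1 : Cd1 = LFy2 * (Lfy1 + Lfy2) + (σψ + μ * LFy2) * (LFy1 + LFy2))
    (hCd2 : Cd2 = LFy2 * ‖grady f 0 0‖ + (σψ + μ * LFy2) * ‖grady F 0 0‖) :
    ∀ D : ℝ, 0 < D → ∀ (x : Eu n) (y : Eu m), ‖x‖ + ‖y‖ ≤ D →
      ‖grady F x (ystar x)‖ ≤ (Cd1 * D + Cd2) / σψ ∧
      ‖vstar x‖ ≤ (Cd1 * D + Cd2) / σψ ^ 2 := by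
  intro D _ x y hD
  set z := ystar x
  have hψ : ContDiff ℝ 2 (aggreg μ F f x) :=
    (contDiff_const.mul (hF.of_uncurry_right x)).add (contDiff_const.mul (hf.of_uncurry_right x))
  have hgrow : ∀ w, σψ * ‖w - z‖ ≤ ‖grady (aggreg μ F f) x w‖ :=
    (hψsc x).mul_norm_sub_le_norm_gradient (hψ.differentiable two_ne_zero) (hmin x)
  have hgz : grady (aggreg μ F f) x z = 0 := by
    have : fderiv ℝ (aggreg μ F f x) z = 0 :=
      IsLocalMin.fderiv_eq_zero (Eventually.of_forall (hmin x))
    change (InnerProductSpace.toDual ℝ _).symm (fderiv ℝ (aggreg μ F f x) z) = 0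
    rw [this, map_zero]
  have hH : ∀ v, σψ * ‖v‖ ≤ ‖hessyy (aggreg μ F f) x z v‖ :=
    (hψ.gradient_one.differentiable one_ne_zero z).hasFDerivAt.mul_norm_le_of_growth hgz hgrow
  have hgradF : ‖grady F x z‖ ≤ (Cd1 * D + Cd2) / σψ := by
    have hFy := norm_grady_le hLFy1 hLFy2 hD
    have hfy := norm_grady_le hLfy1 hLfy2 hD
    have hψy : σψ * ‖y - z‖ ≤ μ * ‖grady F x y‖ + ‖grady f x y‖ := by
      refine (hgrow y).trans ?_
      rw [grady_aggreg hF hf]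
      refine (norm_add_le _ _).trans ?_
      rw [norm_smul, norm_smul, Real.norm_of_nonneg hμ.1.le,
        Real.norm_of_nonneg (sub_nonneg.2 hμ.2)]
      gcongr
      exact mul_le_of_le_one_left (norm_nonneg _) (by linarith [hμ.1])
    have hFz : ‖grady F x z‖ ≤ ‖grady F x y‖ + LFy2 * ‖y - z‖ := by
      have h₁ := (hLFy2 x).norm_sub_le z y
      rw [norm_sub_rev z y] at h₁
      linarith [norm_sub_norm_le (grady F x z) (grady F x y)]
    rw [le_div_iff₀ hσψpos]
    have hμ₀ := hμ.1.le
    calc ‖grady F x z‖ * σψ ≤ (‖grady F x y‖ + LFy2 * ‖y - z‖) * σψ := by gcongr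
      _ = σψ * ‖grady F x y‖ + LFy2 * (σψ * ‖y - z‖) := by ring
      _ ≤ σψ * ‖grady F x y‖ + LFy2 * (μ * ‖grady F x y‖ + ‖grady f x y‖) := by gcongr
      _ = LFy2 * ‖grady f x y‖ + (σψ + μ * LFy2) * ‖grady F x y‖ := by ring
      _ ≤ LFy2 * ((Lfy1 + Lfy2) * D + ‖grady f 0 0‖) +
          (σψ + μ * LFy2) * ((LFy1 + LFy2) * D + ‖grady F 0 0‖) := by gcongr
      _ = Cd1 * D + Cd2 := by rw [hCd1, hCd2]; ring
  refine ⟨hgradF, ?_⟩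
  rw [hvstar x, pow_two, ← div_div, le_div_iff₀' hσψpos]
  exact (ContinuousLinearMap.mul_norm_inverse_apply_le hH _).trans hgradF
end
end

section
/- Under the smoothness and convexity assumptions, for μ with σ_{ψμ} > 0, if the step size satisfies 0 < η ≤ 1/L_{ψμ}, then for any x, y, v, the multiplier update v⁺ := v + η(∇_y F(x,y) − ∇²_{yy} ψ_μ(x,y) v) satisfies ‖v⁺ − v*_μ(x)‖² ≤ (1 − η σ_{ψμ}) ‖v − v*_μ(x)‖² + (2η/σ_{ψμ}) (L_{ψyy2} ‖v*_μ(x)‖ + L_{Fy2})² ‖y − y*_μ(x)‖². -/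
open Set Filter Asymptotics
open scoped NNReal

noncomputable section

variable {n m : ℕ}

open scoped Gradient RealInnerProductSpace

section Hessian

variable {E : Type*} [NormedAddCommGroup E] [InnerProductSpace ℝ E]

/-- A symmetric operator whose quadratic form lies between `0` and `q` has norm at most `q`. -/
theorem norm_apply_le_of_inner_bounds {T : E →L[ℝ] E} {q : ℝ}
    (hsymm : ∀ u w, ⟪T u, w⟫ = ⟪u, T w⟫) (hnonneg : ∀ u, 0 ≤ ⟪T u, u⟫)
    (hle : ∀ u, ⟪T u, u⟫ ≤ q * ‖u‖ ^ 2) (hq : 0 ≤ q) (u : E) : ‖T u‖ ≤ q * ‖u‖ := by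
  have key (s : ℝ) : 0 ≤ q * ‖u‖ ^ 2 - 2 * s * ‖T u‖ ^ 2 + s ^ 2 * (q * ‖T u‖ ^ 2) := by
    have h := hnonneg (u - s • T u)
    have hT : ⟪T (T u), u⟫ = ‖T u‖ ^ 2 := by rw [hsymm, real_inner_self_eq_norm_sq]
    simp only [map_sub, map_smul, inner_sub_left, inner_sub_right, real_inner_smul_left,
      real_inner_smul_right, hT, real_inner_self_eq_norm_sq] at h
    nlinarith [hle u, mul_le_mul_of_nonneg_left (hle (T u)) (sq_nonneg s)]
  refine le_of_sq_le_sq ?_ (by positivity)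
  rcases hq.eq_or_lt with rfl | hq
  · have := key 1
    nlinarith
  · have := key q⁻¹
    field_simp at this
    nlinarith

theorem isInvertible_of_le_inner [FiniteDimensional ℝ E] {T : E →L[ℝ] E} {σ : ℝ} (hσ : 0 < σ)
    (hT : ∀ u, σ * ‖u‖ ^ 2 ≤ ⟪T u, u⟫) : T.IsInvertible := by
  have hinj : Function.Injective (T : E →ₗ[ℝ] E) := by
    rw [injective_iff_map_eq_zero]
    intro u hu
    have h := hT u
    rw [show T u = 0 from hu, inner_zero_left] at h
    by_contra hne
    have : 0 < ‖u‖ := norm_pos_iff.2 hne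
    have : 0 < σ * ‖u‖ ^ 2 := by positivity
    linarith
  exact ⟨(LinearEquiv.ofInjectiveEndo (T : E →ₗ[ℝ] E) hinj).toContinuousLinearEquiv, by ext; rfl⟩

/-- One step of the Richardson iteration for a symmetric operator `H` with `σ ≤ H ≤ L`, perturbed
by `b`. -/
theorem norm_richardson_step_sq_le {H : E →L[ℝ] E} {σ L η : ℝ}
    (hsymm : ∀ u w, ⟪H u, w⟫ = ⟪u, H w⟫) (hlow : ∀ u, σ * ‖u‖ ^ 2 ≤ ⟪H u, u⟫)
    (hup : ‖H‖ ≤ L) (hσ : 0 < σ) (hη : 0 < η) (hηL : η * L ≤ 1) (e b : E) :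
    ‖e - η • H e + η • b‖ ^ 2 ≤ (1 - η * σ) * ‖e‖ ^ 2 + 2 * η / σ * ‖b‖ ^ 2 := by
  rcases subsingleton_or_nontrivial E with hE | hE
  · simp [Subsingleton.elim _ (0 : E)]
  have hup' (u : E) : ⟪H u, u⟫ ≤ L * ‖u‖ ^ 2 := by
    calc ⟪H u, u⟫ ≤ ‖H u‖ * ‖u‖ := real_inner_le_norm _ _
      _ ≤ L * ‖u‖ * ‖u‖ := by gcongr; exact H.le_of_opNorm_le hup u
      _ = L * ‖u‖ ^ 2 := by ring
  have hσL : σ ≤ L := by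
    obtain ⟨u, hu⟩ := exists_ne (0 : E)
    have : 0 < ‖u‖ ^ 2 := by positivity
    exact le_of_mul_le_mul_right ((hlow u).trans (hup' u)) this
  have hq : 0 ≤ 1 - η * σ := by nlinarith
  have hT : ‖e - η • H e‖ ≤ (1 - η * σ) * ‖e‖ := by
    refine norm_apply_le_of_inner_bounds (T := ContinuousLinearMap.id ℝ E - η • H) ?_ ?_ ?_ hq e
    · intro u w
      simp [inner_sub_left, inner_sub_right, real_inner_smul_left, real_inner_smul_right, hsymm]
    · intro u
      simp only [sub_apply, ContinuousLinearMap.id_apply,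
        smul_apply, inner_sub_left, real_inner_smul_left,
        real_inner_self_eq_norm_sq]
      nlinarith [mul_le_mul_of_nonneg_left (hup' u) hη.le, sq_nonneg ‖u‖]
    · intro u
      simp only [sub_apply, ContinuousLinearMap.id_apply,
        smul_apply, inner_sub_left, real_inner_smul_left,
        real_inner_self_eq_norm_sq]
      nlinarith [mul_le_mul_of_nonneg_left (hlow u) hη.le]
  have htri : ‖e - η • H e + η • b‖ ≤ (1 - η * σ) * ‖e‖ + η * ‖b‖ := by
    refine (norm_add_le _ _).trans (add_le_add hT ?_)
    rw [norm_smul, Real.norm_of_nonneg hη.le]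
  obtain ⟨c, hb⟩ : ∃ c, ‖b‖ = σ * c := ⟨‖b‖ / σ, by field_simp⟩
  calc ‖e - η • H e + η • b‖ ^ 2 ≤ ((1 - η * σ) * ‖e‖ + η * ‖b‖) ^ 2 := by gcongr
    _ ≤ (1 - η * σ) * ‖e‖ ^ 2 + η * σ * c ^ 2 := by
      rw [hb]
      nlinarith [mul_nonneg (mul_nonneg hq (mul_pos hη hσ).le) (sq_nonneg (‖e‖ - c))]
    _ ≤ (1 - η * σ) * ‖e‖ ^ 2 + 2 * (η * σ * c ^ 2) := by
      have : 0 ≤ η * σ * c ^ 2 := by positivity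
      linarith
    _ = (1 - η * σ) * ‖e‖ ^ 2 + 2 * η / σ * ‖b‖ ^ 2 := by
      rw [hb]
      field_simp

variable [CompleteSpace E]

theorem differentiable_gradient_of_contDiff_two {g : E → ℝ} (hg : ContDiff ℝ 2 g) :
    Differentiable ℝ (∇ g) := by
  have h : Differentiable ℝ (fderiv ℝ g) :=
    (hg.fderiv_right (m := 1) (by norm_num)).differentiable one_ne_zero
  exact (InnerProductSpace.toDual ℝ E).symm.toContinuousLinearEquiv.differentiable.comp h

theorem inner_fderiv_gradient (g : E → ℝ) (y u w : E) :
    ⟪fderiv ℝ (∇ g) y u, w⟫ = fderiv ℝ (fderiv ℝ g) y u w := by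
  have h := (InnerProductSpace.toDual ℝ E).toContinuousLinearEquiv.comp_fderiv
    (f := ∇ g) (x := y)
  have h' : (InnerProductSpace.toDual ℝ E).toContinuousLinearEquiv ∘ (∇ g) = fderiv ℝ g :=
    toDual_comp_gradient
  rw [h'] at h
  rw [h]
  simp

theorem inner_fderiv_gradient_comm {g : E → ℝ} (hg : ContDiff ℝ 2 g) (y u w : E) :
    ⟪fderiv ℝ (∇ g) y u, w⟫ = ⟪u, fderiv ℝ (∇ g) y w⟫ := by
  rw [inner_fderiv_gradient, real_inner_comm, inner_fderiv_gradient]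
  exact hg.contDiffAt.isSymmSndFDerivAt (by simp) u w

/-- The Hessian of a `σ`-strongly convex function is bounded below by `σ`. -/
theorem StrongConvexOn.le_inner_fderiv_gradient {g : E → ℝ} {σ : ℝ}
    (hsc : StrongConvexOn univ σ g) (hg : ContDiff ℝ 2 g) (y u : E) :
    σ * ‖u‖ ^ 2 ≤ ⟪fderiv ℝ (∇ g) y u, u⟫ := by
  have hconv := (strongConvexOn_iff_convex.1 hsc).comp_affineMap (AffineMap.lineMap y (y + u))
  rw [preimage_univ] at hconv
  have hline (t : ℝ) : HasDerivAt (AffineMap.lineMap y (y + u) : ℝ → E) u t := by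
    simpa using AffineMap.hasDerivAt_lineMap (a := y) (b := y + u) (x := t)
  have hd (t : ℝ) : HasDerivAt
      ((fun x => g x - σ / 2 * ‖x‖ ^ 2) ∘ (AffineMap.lineMap y (y + u) : ℝ → E))
      (⟪∇ g (AffineMap.lineMap y (y + u) t), u⟫ - σ * ⟪AffineMap.lineMap y (y + u) t, u⟫) t := by
    have h1 : HasDerivAt (fun t : ℝ => g (AffineMap.lineMap y (y + u) t))
        ⟪∇ g (AffineMap.lineMap y (y + u) t), u⟫ t := by
      have := ((hg.differentiable two_ne_zero _).hasGradientAt.hasFDerivAt).comp_hasDerivAt t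
        (hline t)
      rw [InnerProductSpace.toDual_apply_apply] at this
      exact this
    have h2 := ((hline t).norm_sq).const_mul (σ / 2)
    rw [← mul_assoc, div_mul_cancel₀ σ two_ne_zero] at h2
    exact h1.sub h2
  have hmono := hconv.monotoneOn_deriv fun t _ => (hd t).differentiableAt
  rw [monotoneOn_univ, funext fun t => (hd t).deriv] at hmono
  have hd2 : HasDerivAt (fun t : ℝ => ⟪∇ g (AffineMap.lineMap y (y + u) t), u⟫ -
      σ * ⟪(AffineMap.lineMap y (y + u) t : E), u⟫)
      (⟪fderiv ℝ (∇ g) y u, u⟫ - σ * ⟪u, u⟫) 0 := by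
    have h1 : HasDerivAt (fun t : ℝ => ∇ g (AffineMap.lineMap y (y + u) t))
        (fderiv ℝ (∇ g) y u) 0 := by
      have := (differentiable_gradient_of_contDiff_two hg
        (AffineMap.lineMap y (y + u) (0 : ℝ))).hasFDerivAt.comp_hasDerivAt (0 : ℝ) (hline 0)
      simpa [Function.comp_def] using this
    have h2 := h1.inner ℝ (hasDerivAt_const (0 : ℝ) u)
    have h3 := ((hline 0).inner ℝ (hasDerivAt_const (0 : ℝ) u)).const_mul σ
    simp only [inner_zero_right, zero_add] at h2 h3
    exact h2.sub h3
  have := hmono.deriv_nonneg (x := 0)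
  rw [hd2.deriv, real_inner_self_eq_norm_sq] at this
  linarith

end Hessian

theorem hessyy_aggreg {μ : ℝ} {F f : Eu n → Eu m → ℝ} {x : Eu n} (hF : ContDiff ℝ 2 (F x))
    (hf : ContDiff ℝ 2 (f x)) (y : Eu m) :
    hessyy (aggreg μ F f) x y = μ • hessyy F x y + (1 - μ) • hessyy f x y := by
  have hgrad : (fun y' => grady (aggreg μ F f) x y') =
      fun y' => μ • grady F x y' + (1 - μ) • grady f x y' := by
    funext y'
    refine HasGradientAt.gradient ?_
    have h := ((hF.differentiable two_ne_zero y').hasGradientAt.hasFDerivAt.const_mul μ).add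
      ((hf.differentiable two_ne_zero y').hasGradientAt.hasFDerivAt.const_mul (1 - μ))
    rw [hasGradientAt_iff_hasFDerivAt]
    rw [map_add, map_smul, map_smul]
    exact h
  have hF' : DifferentiableAt ℝ (fun y' => grady F x y') y :=
    differentiable_gradient_of_contDiff_two hF y
  have hf' : DifferentiableAt ℝ (fun y' => grady f x y') y :=
    differentiable_gradient_of_contDiff_two hf y
  unfold hessyy
  rw [hgrad]
  exact ((hF'.hasFDerivAt.const_smul μ).add (hf'.hasFDerivAt.const_smul (1 - μ))).fderiv

/-- Lemma D.4, `v`-update: contraction of the multiplier update. -/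
theorem multiplier_step_contraction {n m : ℕ}
    (F f : Eu n → Eu m → ℝ)
    (hF : ContDiff ℝ 2 (Function.uncurry F))
    (hf : ContDiff ℝ 2 (Function.uncurry f))
    (LFy2 Lfy2 LFyy2 Lfyy2 : ℝ≥0)
    (hLFy2 : ∀ x, LipschitzWith LFy2 fun y => grady F x y)
    (hLfy2 : ∀ x, LipschitzWith Lfy2 fun y => grady f x y)
    (hLFyy2 : ∀ x, LipschitzWith LFyy2 fun y => hessyy F x y)
    (hLfyy2 : ∀ x, LipschitzWith Lfyy2 fun y => hessyy f x y)
    (σF σf : ℝ) (hσF : 0 < σF) (hσf : 0 ≤ σf)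
    (hFsc : ∀ x, StrongConvexOn univ σF (F x))
    (hfsc : ∀ x, StrongConvexOn univ σf (f x))
    (μ : ℝ) (hμ : μ ∈ Icc (0 : ℝ) 1)
    (σψ Lψ Lψyy2 : ℝ)
    (hσψ : σψ = μ * σF + (1 - μ) * σf) (hσψpos : 0 < σψ)
    (hLψ : Lψ = μ * LFy2 + (1 - μ) * Lfy2)
    (hLψyy2 : Lψyy2 = μ * LFyy2 + (1 - μ) * Lfyy2)
    (ystar : Eu n → Eu m)
    (hmin : ∀ x y, aggreg μ F f x (ystar x) ≤ aggreg μ F f x y)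
    (vstar : Eu n → Eu m)
    (hvstar : ∀ x, vstar x =
      (hessyy (aggreg μ F f) x (ystar x)).inverse (grady F x (ystar x)))
    (η : ℝ) (hηpos : 0 < η) (hη : η ≤ 1 / Lψ) :
    ∀ (x : Eu n) (y v : Eu m),
      ‖(v + η • (grady F x y - hessyy (aggreg μ F f) x y v)) - vstar x‖ ^ 2 ≤
        (1 - η * σψ) * ‖v - vstar x‖ ^ 2 +
          (2 * η / σψ) * (Lψyy2 * ‖vstar x‖ + LFy2) ^ 2 * ‖y - ystar x‖ ^ 2 := by
  intro x y v
  obtain ⟨hμ0, hμ1⟩ := hμ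
  have hμ1' : 0 ≤ 1 - μ := sub_nonneg.2 hμ1
  have hFx : ContDiff ℝ 2 (F x) := hF.comp (contDiff_const.prodMk contDiff_id)
  have hfx : ContDiff ℝ 2 (f x) := hf.comp (contDiff_const.prodMk contDiff_id)
  have hlow (y u : Eu m) : σψ * ‖u‖ ^ 2 ≤ ⟪hessyy (aggreg μ F f) x y u, u⟫ := by
    have h1 : σF * ‖u‖ ^ 2 ≤ ⟪hessyy F x y u, u⟫ := (hFsc x).le_inner_fderiv_gradient hFx y u
    have h2 : σf * ‖u‖ ^ 2 ≤ ⟪hessyy f x y u, u⟫ := (hfsc x).le_inner_fderiv_gradient hfx y u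
    simp only [hessyy_aggreg hFx hfx, add_apply,
      smul_apply, inner_add_left, real_inner_smul_left, hσψ]
    nlinarith [mul_le_mul_of_nonneg_left h1 hμ0, mul_le_mul_of_nonneg_left h2 hμ1']
  have hsymm (u w : Eu m) :
      ⟪hessyy (aggreg μ F f) x y u, w⟫ = ⟪u, hessyy (aggreg μ F f) x y w⟫ := by
    have h1 : ⟪hessyy F x y u, w⟫ = ⟪u, hessyy F x y w⟫ := inner_fderiv_gradient_comm hFx y u w
    have h2 : ⟪hessyy f x y u, w⟫ = ⟪u, hessyy f x y w⟫ := inner_fderiv_gradient_comm hfx y u w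
    simp only [hessyy_aggreg hFx hfx, add_apply,
      smul_apply, inner_add_left, inner_add_right, real_inner_smul_left,
      real_inner_smul_right, h1, h2]
  have hconvex_norm (a b : Eu m →L[ℝ] Eu m) :
      ‖μ • a + (1 - μ) • b‖ ≤ μ * ‖a‖ + (1 - μ) * ‖b‖ := by
    refine (norm_add_le _ _).trans_eq ?_
    rw [norm_smul, norm_smul, Real.norm_of_nonneg hμ0, Real.norm_of_nonneg hμ1']
  have hup : ‖hessyy (aggreg μ F f) x y‖ ≤ Lψ := by
    rw [hessyy_aggreg hFx hfx, hLψ]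
    refine (hconvex_norm _ _).trans ?_
    gcongr
    · exact norm_fderiv_le_of_lipschitz ℝ (hLFy2 x)
    · exact norm_fderiv_le_of_lipschitz ℝ (hLfy2 x)
  have hηL : η * Lψ ≤ 1 := by
    have hL0 : 0 < Lψ := one_div_pos.1 (hηpos.trans_le hη)
    exact (le_div_iff₀ hL0).1 hη
  have hKKT : hessyy (aggreg μ F f) x (ystar x) (vstar x) = grady F x (ystar x) := by
    rw [hvstar]
    exact (isInvertible_of_le_inner hσψpos (hlow (ystar x))).self_apply_inverse _
  have hdiff : ‖hessyy (aggreg μ F f) x y - hessyy (aggreg μ F f) x (ystar x)‖ ≤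
      Lψyy2 * ‖y - ystar x‖ := by
    have heq : hessyy (aggreg μ F f) x y - hessyy (aggreg μ F f) x (ystar x) =
        μ • (hessyy F x y - hessyy F x (ystar x)) +
          (1 - μ) • (hessyy f x y - hessyy f x (ystar x)) := by
      rw [hessyy_aggreg hFx hfx, hessyy_aggreg hFx hfx]
      module
    rw [heq, hLψyy2, add_mul, mul_assoc, mul_assoc]
    refine (hconvex_norm _ _).trans ?_
    gcongr
    · exact (hLFyy2 x).norm_sub_le y (ystar x)
    · exact (hLfyy2 x).norm_sub_le y (ystar x)
  have hb : ‖grady F x y - hessyy (aggreg μ F f) x y (vstar x)‖ ≤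
      (Lψyy2 * ‖vstar x‖ + LFy2) * ‖y - ystar x‖ := by
    have heq : grady F x y - hessyy (aggreg μ F f) x y (vstar x) =
        (grady F x y - grady F x (ystar x)) -
          (hessyy (aggreg μ F f) x y - hessyy (aggreg μ F f) x (ystar x)) (vstar x) := by
      rw [sub_apply, hKKT]
      abel
    rw [heq]
    have h1 := (hLFy2 x).norm_sub_le y (ystar x)
    have h2 := ContinuousLinearMap.le_of_opNorm_le _ hdiff (vstar x)
    refine (norm_sub_le _ _).trans ((add_le_add h1 h2).trans_eq ?_)
    ring
  have hstep : (v + η • (grady F x y - hessyy (aggreg μ F f) x y v)) - vstar x =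
      (v - vstar x) - η • hessyy (aggreg μ F f) x y (v - vstar x) +
        η • (grady F x y - hessyy (aggreg μ F f) x y (vstar x)) := by
    rw [map_sub]
    module
  rw [hstep, mul_assoc (2 * η / σψ), ← mul_pow]
  refine (norm_richardson_step_sq_le hsymm (hlow y) hup hσψpos hηpos hηL _ _).trans ?_
  gcongr
end
end
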